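/- arXiv:1502.05657 — 5 statements merged into one kernel-verified Lean document; each statement's English description precedes it below -/
import Mathlib

section
/- Let F be a field with char F ≠ 2 and let a, b be row vectors in F^m. Set s := a·a and suppose s ≠ 0, and let k ∈ F be such that b·b = k·s ≠ 0 and a·b = −k·s/2. Set c := a + b (note that then c·c = s). Then the Jordan product of the projection matrices onto the spans of a and b satisfies (1/2)(m_a m_b + m_b m_a) = (1/4)(m_a + k·m_b − m_c). (This is the multiplication rule for projection matrices of roots a, b generating a rank-2 root system of type A_2, B_2 or G_2, where k = ‖b‖²/‖a‖² ∈ {1,2,3}.) -/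
open Matrix

/-- Multiplication rule for projection matrices of two roots `a`, `b`
generating a rank-2 root system of type `A₂`, `B₂` or `G₂`, where `k = ‖b‖²/‖a‖²`.
Here `m_v = (v·v)⁻¹ • vᵀv` is the projection matrix onto the span of the row vector `v`,
and the Jordan product is `X ∙ Y = (1/2)(XY + YX)`. -/
theorem stmt_0 {F : Type*} [Field F] (h2 : (2 : F) ≠ 0) {m : ℕ} (a b : Fin m → F) (k : F)
    (hs : a ⬝ᵥ a ≠ 0) (hbb : b ⬝ᵥ b = k * (a ⬝ᵥ a)) (hbb0 : b ⬝ᵥ b ≠ 0)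
    (hab : a ⬝ᵥ b = -(k * (a ⬝ᵥ a)) / 2) :
    (2⁻¹ : F) • (((a ⬝ᵥ a)⁻¹ • vecMulVec a a) * ((b ⬝ᵥ b)⁻¹ • vecMulVec b b) +
        ((b ⬝ᵥ b)⁻¹ • vecMulVec b b) * ((a ⬝ᵥ a)⁻¹ • vecMulVec a a)) =
      (4⁻¹ : F) • (((a ⬝ᵥ a)⁻¹ • vecMulVec a a) + k • ((b ⬝ᵥ b)⁻¹ • vecMulVec b b) -
        (((a + b) ⬝ᵥ (a + b))⁻¹ • vecMulVec (a + b) (a + b))) := by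
  have h4 : (4 : F) ≠ 0 := by
    have h : (4 : F) = 2 * 2 := by norm_num
    rw [h]
    exact mul_ne_zero h2 h2
  have hk : k ≠ 0 := by
    rintro rfl
    exact hbb0 (by rw [hbb, zero_mul])
  have hba : b ⬝ᵥ a = -(k * (a ⬝ᵥ a)) / 2 := by rw [dotProduct_comm, hab]
  have hc : (a + b) ⬝ᵥ (a + b) = a ⬝ᵥ a := by
    rw [add_dotProduct, dotProduct_add, dotProduct_add, hab, hba, hbb]
    field_simp
    ring
  rw [hc]
  simp only [smul_mul_assoc, mul_smul_comm, vecMulVec_mul_vecMulVec, hab, hba, hbb]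
  generalize a ⬝ᵥ a = s at hs
  ext i j
  simp only [Matrix.smul_apply, Matrix.add_apply, Matrix.sub_apply, vecMulVec_apply,
    Pi.smul_apply, Pi.add_apply, smul_eq_mul]
  have h42 : (4 : F) = 2 * 2 := by norm_num
  rw [h42]
  field_simp
  ring
end

section
/- Let F be a field with char F ∉ {2,3} and let A be the Matsuo algebra of the affine plane of order 3 over F, with identity 1 = (1/3) Σ_{u∈P} p_u. For every line L of the affine plane, the elements f_L := (2/3) Σ_{u∈L} p_u and e_L := 1 − f_L = −(1/3) Σ_{u∈L} p_u + (1/3) Σ_{u∉L} p_u are idempotents of A, i.e. f_L f_L = f_L and e_L e_L = e_L. -/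
open Finset

/-- The Matsuo algebra `M_{1/2}(P3)` of the affine plane of order 3 over `F`: the free
`F`-module on the point set `P = (ℤ/3)²`, with the commutative bilinear multiplication
determined by `p_u p_u = p_u` and `p_u p_v = (1/4)(p_u + p_v − p_{−u−v})` for `u ≠ v`. -/
noncomputable def mMul (F : Type*) [Field F] (x y : ZMod 3 × ZMod 3 → F) :
    ZMod 3 × ZMod 3 → F :=
  ∑ u : ZMod 3 × ZMod 3, ∑ v : ZMod 3 × ZMod 3,
    (x u * y v) •
      (if u = v then Pi.single u (1 : F)
       else (4⁻¹ : F) • (Pi.single u (1 : F) + Pi.single v (1 : F) -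
         Pi.single (-u - v) (1 : F)) : ZMod 3 × ZMod 3 → F)

/-- The sum `Σ_{u ∈ s} p_u` in the Matsuo algebra. -/
noncomputable def pSum (F : Type*) [Field F] (s : Finset (ZMod 3 × ZMod 3)) :
    ZMod 3 × ZMod 3 → F :=
  ∑ u ∈ s, Pi.single u 1

/-- The line of the affine plane of order 3 through `a` with direction `w`
(a coset of the 1-dimensional subspace spanned by `w`). -/
def lineThru (a w : ZMod 3 × ZMod 3) : Finset (ZMod 3 × ZMod 3) :=
  Finset.image (fun t : ZMod 3 => a + t • w) Finset.univ


/-- Four times the structure constants of the Matsuo algebra, as integers. -/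
def cInt (u v k : ZMod 3 × ZMod 3) : ℤ :=
  if u = v then (if k = u then 4 else 0)
  else (if k = u then 1 else 0) + (if k = v then 1 else 0) - (if k = -u - v then 1 else 0)

/-- Four times the square of an integral vector. -/
def nInt (g : ZMod 3 × ZMod 3 → ℤ) (k : ZMod 3 × ZMod 3) : ℤ :=
  ∑ u : ZMod 3 × ZMod 3, ∑ v : ZMod 3 × ZMod 3, g u * g v * cInt u v k

/-- Indicator function of a line. -/
def chi (a w k : ZMod 3 × ZMod 3) : ℤ := if k ∈ lineThru a w then 1 else 0

lemma cInt_eq : ∀ u v k : ZMod 3 × ZMod 3, cInt u v k =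
    (if k = u then 1 else 0) + (if k = v then 1 else 0) - (if v = -u - k then 1 else 0)
      + 3 * (if k = u then (if k = v then 1 else 0) else 0) := by
  decide +kernel

lemma nInt_eq (g : ZMod 3 × ZMod 3 → ℤ) (k : ZMod 3 × ZMod 3) :
    nInt g k = 2 * g k * (∑ u, g u) + 3 * g k ^ 2 - ∑ u, g u * g (-u - k) := by
  unfold nInt
  simp only [cInt_eq, mul_add, mul_sub, Finset.sum_add_distrib, Finset.sum_sub_distrib,
    mul_ite, mul_one, mul_zero, Finset.sum_ite_eq, Finset.sum_ite_eq', Finset.mem_univ, if_true,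
    Finset.sum_ite_irrel, Finset.sum_const_zero, ← Finset.mul_sum, ← Finset.sum_mul]
  ring

lemma chi_eq (a w : ZMod 3 × ZMod 3) (hw : w ≠ 0) (k : ZMod 3 × ZMod 3) :
    chi a w k = (if k = a then 1 else 0) + (if k = a + w then 1 else 0)
      + (if k = a - w then 1 else 0) := by
  revert a w k
  decide +kernel

lemma chi_sq (a w k : ZMod 3 × ZMod 3) : chi a w k ^ 2 = chi a w k := by
  unfold chi
  split_ifs <;> norm_num

lemma sum_chi (a w : ZMod 3 × ZMod 3) (hw : w ≠ 0) : ∑ u, chi a w u = 3 := by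
  simp only [chi_eq a w hw, Finset.sum_add_distrib, Finset.sum_ite_eq', Finset.mem_univ, if_true]
  norm_num

/-- A line through two of the three points `u`, `-u-k`, `k` contains the third. -/
lemma sum_chi_conv (a w : ZMod 3 × ZMod 3) (hw : w ≠ 0) (k : ZMod 3 × ZMod 3) :
    ∑ u, chi a w u * chi a w (-u - k) = 3 * chi a w k := by
  have key : ∀ a w : ZMod 3 × ZMod 3, w ≠ 0 → ∀ k,
      chi a w (-a - k) + chi a w (-(a + w) - k) + chi a w (-(a - w) - k) = 3 * chi a w k := by
    decide +kernel
  rw [← key a w hw k]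
  simp only [chi_eq a w hw, add_mul, ite_mul, one_mul, zero_mul, Finset.sum_add_distrib,
    Finset.sum_ite_eq', Finset.mem_univ, if_true]

lemma nInt_chi (a w : ZMod 3 × ZMod 3) (hw : w ≠ 0) (k : ZMod 3 × ZMod 3) :
    nInt (chi a w) k = 6 * chi a w k := by
  rw [nInt_eq, sum_chi a w hw, sum_chi_conv a w hw, chi_sq]
  ring

lemma nInt_e (a w : ZMod 3 × ZMod 3) (hw : w ≠ 0) (k : ZMod 3 × ZMod 3) :
    nInt (fun u => 1 - 2 * chi a w u) k = 12 * (1 - 2 * chi a w k) := by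
  have h1 := sum_chi a w hw
  have h2 : ∑ u, chi a w (-u - k) = 3 := by
    rw [← h1]
    refine Fintype.sum_equiv ((Equiv.neg _).trans (Equiv.subRight k)) _ _ fun u => rfl
  have h3 := sum_chi_conv a w hw k
  have h4 : ∑ u, (1 - 2 * chi a w u) = 3 := by
    rw [Finset.sum_sub_distrib, ← Finset.mul_sum, h1]
    simp [Finset.card_univ, ZMod.card]
  have h5 : ∑ u, (1 - 2 * chi a w u) * (1 - 2 * chi a w (-u - k)) = 12 * chi a w k - 3 := by
    have : ∀ u, (1 - 2 * chi a w u) * (1 - 2 * chi a w (-u - k)) =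
        (1 - 2 * chi a w u) - 2 * chi a w (-u - k) + 4 * (chi a w u * chi a w (-u - k)) := by
      intro u; ring
    simp only [this]
    rw [Finset.sum_add_distrib, Finset.sum_sub_distrib, h4, ← Finset.mul_sum, ← Finset.mul_sum,
      h2, h3]
    ring
  rw [nInt_eq, h4, h5]
  linear_combination 12 * chi_sq a w k

lemma mMul_int (F : Type*) [Field F] (h2 : (2 : F) ≠ 0) (c : F) (g : ZMod 3 × ZMod 3 → ℤ)
    (k : ZMod 3 × ZMod 3) :
    mMul F (fun u => c * (g u : F)) (fun u => c * (g u : F)) k = c ^ 2 * 4⁻¹ * (nInt g k : F) := by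
  have h4 : (4 : F) ≠ 0 := by
    have : (4 : F) = 2 * 2 := by norm_num
    rw [this]; exact mul_ne_zero h2 h2
  unfold mMul nInt
  push_cast
  simp only [Finset.sum_apply, Finset.mul_sum]
  refine Finset.sum_congr rfl fun u _ => Finset.sum_congr rfl fun v _ => ?_
  unfold cInt
  by_cases h : u = v
  · simp only [h, if_true, Pi.smul_apply, Pi.single_apply, smul_eq_mul]
    split_ifs <;> push_cast <;> field_simp <;> ring
  · simp only [h, if_false, Pi.smul_apply, Pi.sub_apply, Pi.add_apply, Pi.single_apply,
      smul_eq_mul]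
    push_cast
    ring

lemma pSum_eq (F : Type*) [Field F] (s : Finset (ZMod 3 × ZMod 3)) (k : ZMod 3 × ZMod 3) :
    pSum F s k = if k ∈ s then 1 else 0 := by
  simp [pSum, Finset.sum_apply, Pi.single_apply]

theorem stmt_6 (F : Type*) [Field F] (h2 : (2 : F) ≠ 0) (h3 : (3 : F) ≠ 0) :
    ∀ a w : ZMod 3 × ZMod 3, w ≠ 0 →
      (let fL : ZMod 3 × ZMod 3 → F := (2 / 3 : F) • pSum F (lineThru a w)
      let eL : ZMod 3 × ZMod 3 → F := (3⁻¹ : F) • pSum F Finset.univ - fL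
      mMul F fL fL = fL ∧ mMul F eL eL = eL) := by
  intro a w hw fL eL
  have h4 : (4 : F) ≠ 0 := by
    have : (4 : F) = 2 * 2 := by norm_num
    rw [this]; exact mul_ne_zero h2 h2
  have hf : fL = fun u => (2 / 3 : F) * (chi a w u : F) := by
    funext u
    simp [fL, pSum_eq, chi]
  have he : eL = fun u => (3⁻¹ : F) * ((1 - 2 * chi a w u : ℤ) : F) := by
    funext u
    simp only [eL, hf, Pi.sub_apply, Pi.smul_apply, pSum_eq, Finset.mem_univ, if_true, smul_eq_mul]
    push_cast
    ring
  constructor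
  · rw [hf]
    funext k
    rw [mMul_int F h2, nInt_chi a w hw]
    push_cast
    field_simp
    ring
  · rw [he]
    funext k
    rw [mMul_int F h2 _ (fun u => 1 - 2 * chi a w u), nInt_e a w hw]
    push_cast
    field_simp
    ring
end

section
/- Let F be a field with char F ∉ {2,3}, let A be the Matsuo algebra of the affine plane of order 3 over F, and let {L₁, L₂, L₃} be a parallel class of lines (the three cosets of one 1-dimensional subspace), with idempotents e_i := e_{L_i}. Set A_{ii} := F·e_i, and for i ≠ j set A_{ij} := (the (1/2)-eigenspace of e_i) ∩ (the (1/2)-eigenspace of e_j), where eigenspaces are taken for left multiplication. Then for any {i,j,k} = {1,2,3} one has A_{ij} = { Σ_{u∈L_k} λ_u p_u : Σ_u λ_u = 0 }, so dim A_{ij} = 2, and A is the internal direct sum A = A_{11} ⊕ A_{22} ⊕ A_{33} ⊕ A_{12} ⊕ A_{13} ⊕ A_{23}. -/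
open Finset

/-- The linear functional whose level sets are the lines of direction `w`. -/
def phiW (w z : ZMod 3 × ZMod 3) : ZMod 3 := w.1 * z.2 - w.2 * z.1

/-- Sum of the coefficients of `x` on the level set `c`. -/
noncomputable def sW {F : Type*} [Field F] (w : ZMod 3 × ZMod 3) (c : ZMod 3)
    (x : ZMod 3 × ZMod 3 → F) : F := ∑ z, if phiW w z = c then x z else 0

lemma mem_line : ∀ w : ZMod 3 × ZMod 3, w ≠ 0 → ∀ a z : ZMod 3 × ZMod 3,
    z ∈ lineThru a w ↔ phiW w z = phiW w a := by
  unfold lineThru phiW; decide +kernel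

lemma line_eq (a w : ZMod 3 × ZMod 3) (hw : w ≠ 0) :
    lineThru a w = Finset.univ.filter (fun z => phiW w z = phiW w a) := by
  ext z; simp [mem_line w hw]

lemma phi_surj : ∀ w : ZMod 3 × ZMod 3, w ≠ 0 → ∀ c, ∃ z, phiW w z = c := by
  unfold phiW; decide +kernel

lemma phi_card : ∀ w : ZMod 3 × ZMod 3, w ≠ 0 → ∀ c,
    (Finset.univ.filter (fun z => phiW w z = c)).card = 3 := by
  unfold phiW; decide +kernel

lemma sum_line {F : Type*} [Field F] (a w : ZMod 3 × ZMod 3) (hw : w ≠ 0)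
    (x : ZMod 3 × ZMod 3 → F) : ∑ u ∈ lineThru a w, x u = sW w (phiW w a) x := by
  rw [line_eq a w hw, Finset.sum_filter]; rfl

lemma pSum_apply {F : Type*} [Field F] (s : Finset (ZMod 3 × ZMod 3)) (z) :
    pSum F s z = if z ∈ s then 1 else 0 := by
  simp [pSum, Finset.sum_apply, Pi.single_apply]

lemma comb_apply {F : Type*} [Field F] (s : Finset (ZMod 3 × ZMod 3))
    (g : ZMod 3 × ZMod 3 → F) (z) :
    (∑ u ∈ s, g u • (Pi.single u 1 : ZMod 3 × ZMod 3 → F)) z = if z ∈ s then g z else 0 := by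
  simp [Finset.sum_apply, Pi.single_apply]

lemma mMul_apply {F : Type*} [Field F] (h2 : (2 : F) ≠ 0) (y x : ZMod 3 × ZMod 3 → F) (z) :
    mMul F y x z = 4⁻¹ * (y z * (∑ v, x v) + (∑ u, y u) * x z - ∑ u, y u * x (-u - z))
      + 3 * 4⁻¹ * (y z * x z) := by
  have h4 : (4 : F) ≠ 0 := by
    have : (4 : F) = 2 * 2 := by norm_num
    rw [this]; exact mul_ne_zero h2 h2
  have hz : ∀ u v : ZMod 3 × ZMod 3, (z = -u - v) ↔ v = -u - z := by
    intro u v; constructor <;> (rintro rfl; abel)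
  have h0 : ∀ u : ZMod 3 × ZMod 3, -u - u = u := by decide +kernel
  have key : ∀ u v : ZMod 3 × ZMod 3, ((y u * x v) •
      (if u = v then Pi.single u (1 : F)
       else (4⁻¹ : F) • (Pi.single u (1 : F) + Pi.single v (1 : F) -
         Pi.single (-u - v) (1 : F)) : ZMod 3 × ZMod 3 → F)) z
      = 4⁻¹ * ((if z = u then y u * x v else 0) + (if z = v then y u * x v else 0)
        - (if v = -u - z then y u * x v else 0))
        + (if u = v then (if z = u then 3 * 4⁻¹ * (y u * x v) else 0) else 0) := by
    intro u v
    by_cases huv : u = v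
    · subst huv
      simp only [← hz u u, h0]
      by_cases hzu : z = u
      · subst hzu
        simp; field_simp; ring
      · simp [Pi.single_apply, hzu]
    · simp only [← hz u v]
      simp only [huv, if_false, Pi.smul_apply, Pi.sub_apply, Pi.add_apply, Pi.single_apply,
        smul_eq_mul]
      split_ifs <;> ring
  unfold mMul
  simp only [Finset.sum_apply, key, Finset.sum_add_distrib, Finset.sum_sub_distrib,
    ← Finset.mul_sum]
  congr 1
  · congr 1
    congr 1
    · congr 1
      · rw [Finset.sum_comm]
        simp [Finset.mul_sum]
      · simp [Finset.sum_mul]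
    · simp
  · simp

/-- the idempotent of the level set `c`. -/
noncomputable def eW (F : Type*) [Field F] (w : ZMod 3 × ZMod 3) (c : ZMod 3) :
    ZMod 3 × ZMod 3 → F := fun z => if phiW w z = c then -3⁻¹ else 3⁻¹

lemma e_eq {F : Type*} [Field F] (h3 : (3 : F) ≠ 0) (a w : ZMod 3 × ZMod 3) (hw : w ≠ 0) :
    (3⁻¹ : F) • pSum F Finset.univ - (2 / 3 : F) • pSum F (lineThru a w)
      = eW F w (phiW w a) := by
  ext z
  simp only [eW, Pi.sub_apply, Pi.smul_apply, pSum_apply, mem_line w hw, Finset.mem_univ,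
    if_true, smul_eq_mul]
  split_ifs <;> field_simp <;> ring

lemma sum_three {F : Type*} [Field F] (w : ZMod 3 × ZMod 3) (x : ZMod 3 × ZMod 3 → F)
    (c d k : ZMod 3) (hcd : c ≠ d) (hck : c ≠ k) (hdk : d ≠ k) :
    ∑ z, x z = sW w c x + sW w d x + sW w k x := by
  unfold sW
  rw [← Finset.sum_add_distrib, ← Finset.sum_add_distrib]
  refine Finset.sum_congr rfl fun z _ => ?_
  have : ∀ c d k t : ZMod 3, c ≠ d → c ≠ k → d ≠ k → t = c ∨ t = d ∨ t = k := by decide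
  rcases this c d k (phiW w z) hcd hck hdk with h | h | h <;>
    simp [h, hcd, hck, hdk, hcd.symm, hck.symm, hdk.symm]

lemma sW_const {F : Type*} [Field F] (w : ZMod 3 × ZMod 3) (hw : w ≠ 0) (c : ZMod 3) (t : F) :
    sW w c (fun _ => t) = 3 * t := by
  unfold sW
  rw [← Finset.sum_filter, Finset.sum_const, phi_card w hw c]; simp

lemma sW_congr {F : Type*} [Field F] (w : ZMod 3 × ZMod 3) (c : ZMod 3)
    (x y : ZMod 3 × ZMod 3 → F) (h : ∀ z, phiW w z = c → x z = y z) : sW w c x = sW w c y := by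
  unfold sW
  refine Finset.sum_congr rfl fun z _ => ?_
  split_ifs with hz
  · exact h z hz
  · rfl

lemma sW_add {F : Type*} [Field F] (w : ZMod 3 × ZMod 3) (c : ZMod 3)
    (x y : ZMod 3 × ZMod 3 → F) : sW w c (x + y) = sW w c x + sW w c y := by
  unfold sW
  rw [← Finset.sum_add_distrib]
  refine Finset.sum_congr rfl fun z _ => ?_
  split_ifs <;> simp

lemma sW_smul {F : Type*} [Field F] (w : ZMod 3 × ZMod 3) (c : ZMod 3) (t : F)
    (x : ZMod 3 × ZMod 3 → F) : sW w c (t • x) = t * sW w c x := by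
  unfold sW
  rw [Finset.mul_sum]
  refine Finset.sum_congr rfl fun z _ => ?_
  split_ifs <;> simp

lemma sW_eW {F : Type*} [Field F] (h3 : (3 : F) ≠ 0) (w : ZMod 3 × ZMod 3) (hw : w ≠ 0)
    (c d : ZMod 3) : sW w d (eW F w c) = if d = c then -1 else 1 := by
  rw [sW_congr w d (eW F w c) (fun _ => if d = c then -3⁻¹ else 3⁻¹), sW_const w hw]
  · split_ifs <;> field_simp
  · rintro z rfl; rfl

lemma conv_apply {F : Type*} [Field F] (h3 : (3 : F) ≠ 0) (w : ZMod 3 × ZMod 3)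
    (c : ZMod 3) (x : ZMod 3 × ZMod 3 → F) (z) :
    ∑ u, eW F w c u * x (-u - z) = 3⁻¹ * (∑ v, x v) - 2 / 3 * sW w (-c - phiW w z) x := by
  have e : ∑ u, eW F w c u * x (-u - z) = ∑ v, eW F w c (-v - z) * x v := by
    refine Fintype.sum_equiv ((Equiv.neg _).trans (Equiv.addRight (-z))) _ _ fun u => ?_
    simp only [Equiv.trans_apply, Equiv.neg_apply, Equiv.coe_addRight]
    congr 2 <;> abel
  rw [e, sW, Finset.mul_sum, Finset.mul_sum, ← Finset.sum_sub_distrib]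
  refine Finset.sum_congr rfl fun v _ => ?_
  have hp : phiW w (-v - z) = c ↔ phiW w v = -c - phiW w z := by
    have : phiW w (-v - z) = - phiW w v - phiW w z := by simp [phiW]; ring
    rw [this]; constructor
    · rintro rfl; ring
    · intro h; rw [h]; ring
  simp only [eW, hp]
  split_ifs <;> field_simp <;> ring

lemma eig_apply {F : Type*} [Field F] (h2 : (2 : F) ≠ 0) (h3 : (3 : F) ≠ 0)
    (w : ZMod 3 × ZMod 3) (hw : w ≠ 0) (c : ZMod 3) (x : ZMod 3 × ZMod 3 → F) (z) :
    mMul F (eW F w c) x z = if phiW w z = c then (sW w c x - ∑ v, x v) / 6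
      else sW w (-c - phiW w z) x / 6 + x z / 2 := by
  have h4 : (4 : F) ≠ 0 := by
    have : (4 : F) = 2 * 2 := by norm_num
    rw [this]; exact mul_ne_zero h2 h2
  have h6 : (6 : F) ≠ 0 := by
    have : (6 : F) = 2 * 3 := by norm_num
    rw [this]; exact mul_ne_zero h2 h3
  have hs : ∑ u, eW F w c u = 1 := by
    have hd : ∀ c : ZMod 3, c ≠ c + 1 ∧ c ≠ c + 2 ∧ c + 1 ≠ c + 2 := by decide
    obtain ⟨a, b, d⟩ := hd c
    rw [sum_three w _ c (c+1) (c+2) a b d]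
    simp only [sW_eW h3 w hw, if_neg a.symm, if_neg b.symm]; simp
  rw [mMul_apply h2, hs, conv_apply h3]
  have hc : ∀ c : ZMod 3, -c - c = c := by decide
  by_cases h : phiW w z = c
  · simp only [eW, h, if_true, hc]; field_simp; ring
  · simp only [eW, h, if_false]; field_simp; ring

lemma eig_iff {F : Type*} [Field F] (h2 : (2 : F) ≠ 0) (h3 : (3 : F) ≠ 0)
    (w : ZMod 3 × ZMod 3) (hw : w ≠ 0) (c : ZMod 3) (x : ZMod 3 × ZMod 3 → F) :
    mMul F (eW F w c) x = (2⁻¹ : F) • x ↔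
      (∀ z, phiW w z = c → x z = 0) ∧ ∀ d, d ≠ c → sW w d x = 0 := by
  have h6 : (6 : F) ≠ 0 := by
    have : (6 : F) = 2 * 3 := by norm_num
    rw [this]; exact mul_ne_zero h2 h3
  have hd : ∀ c : ZMod 3, c ≠ c + 1 ∧ c ≠ c + 2 ∧ c + 1 ≠ c + 2 := by decide
  obtain ⟨p, q, r⟩ := hd c
  have hS := sum_three w x c (c+1) (c+2) p q r
  have hne : ∀ c d : ZMod 3, d ≠ c → -c - d ≠ c := by decide
  rw [funext_iff]
  constructor
  · intro h
    have B : ∀ d, d ≠ c → sW w d x = 0 := by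
      intro d hdc
      obtain ⟨z, hz⟩ := phi_surj w hw (-c - d)
      have := h z
      rw [eig_apply h2 h3 w hw, hz, if_neg (hne c d hdc)] at this
      have e : -c - (-c - d) = d := by ring
      rw [e, Pi.smul_apply, smul_eq_mul] at this
      have : sW w d x / 6 = 0 := by linear_combination this
      simpa [h6] using this
    refine ⟨fun z hz => ?_, B⟩
    have := h z
    rw [eig_apply h2 h3 w hw, if_pos hz, hS, B _ p.symm, B _ q.symm] at this
    simpa [h2] using this
  · rintro ⟨A, B⟩ z
    rw [eig_apply h2 h3 w hw]
    split_ifs with hz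
    · rw [hS, B _ p.symm, B _ q.symm]; simp [A z hz]
    · rw [B _ (hne c _ hz)]; simp; ring

/-- Vectors supported on the level set `k` with coefficient sum zero. -/
def KW (F : Type*) [Field F] (w : ZMod 3 × ZMod 3) (k : ZMod 3) :
    Submodule F (ZMod 3 × ZMod 3 → F) where
  carrier := {x | (∀ z, phiW w z ≠ k → x z = 0) ∧ sW w k x = 0}
  add_mem' := by
    rintro x y ⟨a, b⟩ ⟨c, d⟩
    refine ⟨fun z hz => ?_, ?_⟩
    · simp [a z hz, c z hz]
    · rw [sW_add, b, d, add_zero]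
  zero_mem' := ⟨fun _ _ => rfl, by simp [sW]⟩
  smul_mem' := by
    rintro t x ⟨a, b⟩
    refine ⟨fun z hz => ?_, ?_⟩
    · simp [a z hz]
    · rw [sW_smul, b, mul_zero]

lemma mem_KW {F : Type*} [Field F] {w : ZMod 3 × ZMod 3} {k : ZMod 3}
    {x : ZMod 3 × ZMod 3 → F} :
    x ∈ KW F w k ↔ (∀ z, phiW w z ≠ k → x z = 0) ∧ sW w k x = 0 := Iff.rfl

lemma sW_off {F : Type*} [Field F] {w : ZMod 3 × ZMod 3} {k c : ZMod 3}
    {x : ZMod 3 × ZMod 3 → F} (h : x ∈ KW F w k) : sW w c x = 0 := by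
  by_cases hc : c = k
  · rw [hc]; exact h.2
  · unfold sW
    refine Finset.sum_eq_zero fun z _ => ?_
    split_ifs with hz
    · exact h.1 z (hz ▸ hc)
    · rfl

lemma A_eq {F : Type*} [Field F] (h2 : (2 : F) ≠ 0) (h3 : (3 : F) ≠ 0)
    (w : ZMod 3 × ZMod 3) (hw : w ≠ 0) (c d k : ZMod 3) (hcd : c ≠ d) (hck : c ≠ k)
    (hdk : d ≠ k) :
    {x | mMul F (eW F w c) x = (2⁻¹ : F) • x ∧ mMul F (eW F w d) x = (2⁻¹ : F) • x}
      = (KW F w k : Set (ZMod 3 × ZMod 3 → F)) := by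
  have h : ∀ c d k t : ZMod 3, c ≠ d → c ≠ k → d ≠ k → t ≠ k → t = c ∨ t = d := by decide
  ext x
  simp only [Set.mem_setOf_eq, SetLike.mem_coe, eig_iff h2 h3 w hw]
  constructor
  · rintro ⟨⟨a, b⟩, ⟨a', b'⟩⟩
    refine ⟨fun z hz => ?_, b k hck.symm⟩
    rcases h c d k _ hcd hck hdk hz with h | h
    · exact a z h
    · exact a' z h
  · intro hx
    exact ⟨⟨fun z hz => hx.1 z (hz ▸ hck), fun _ _ => sW_off hx⟩,
      ⟨fun z hz => hx.1 z (hz ▸ hdk), fun _ _ => sW_off hx⟩⟩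

lemma T_eq {F : Type*} [Field F] (a w : ZMod 3 × ZMod 3) (hw : w ≠ 0) :
    {x | ∃ g : ZMod 3 × ZMod 3 → F, (∑ u ∈ lineThru a w, g u) = 0 ∧
        x = ∑ u ∈ lineThru a w, g u • (Pi.single u 1 : ZMod 3 × ZMod 3 → F)}
      = (KW F w (phiW w a) : Set (ZMod 3 × ZMod 3 → F)) := by
  ext x
  simp only [Set.mem_setOf_eq, SetLike.mem_coe]
  constructor
  · rintro ⟨g, hg, rfl⟩
    refine ⟨fun z hz => ?_, ?_⟩
    · rw [comb_apply, if_neg]; rwa [mem_line w hw]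
    · rw [← hg, sum_line a w hw]
      refine sW_congr _ _ _ _ fun z hz => ?_
      rw [comb_apply, if_pos]; rwa [mem_line w hw]
  · intro hx
    refine ⟨x, by rw [sum_line a w hw]; exact hx.2, ?_⟩
    ext z
    rw [comb_apply]
    split_ifs with hz
    · rfl
    · rw [mem_line w hw] at hz; exact hx.1 z hz

lemma three_points : ∀ w : ZMod 3 × ZMod 3, w ≠ 0 → ∀ k, ∃ a b c : ZMod 3 × ZMod 3,
    a ≠ b ∧ a ≠ c ∧ b ≠ c ∧ ∀ z, phiW w z = k ↔ (z = a ∨ z = b ∨ z = c) := by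
  intro w hw k
  obtain ⟨a, b, c, hab, hac, hbc, h⟩ := Finset.card_eq_three.1 (phi_card w hw k)
  refine ⟨a, b, c, hab, hac, hbc, fun z => ?_⟩
  have := Finset.ext_iff.1 h z
  simpa using this

lemma KW_finrank {F : Type*} [Field F] (w : ZMod 3 × ZMod 3) (hw : w ≠ 0) (k : ZMod 3) :
    Module.finrank F (KW F w k) = 2 := by
  obtain ⟨a, b, c, hab, hac, hbc, h⟩ := three_points w hw k
  have hs : ∀ x : ZMod 3 × ZMod 3 → F, sW w k x = x a + x b + x c := by
    intro x
    have : (Finset.univ.filter (fun z => phiW w z = k)) = {a, b, c} := by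
      ext z; simp [h]
    unfold sW
    rw [← Finset.sum_filter, this, Finset.sum_insert (by simp [hab, hac]),
      Finset.sum_pair hbc, add_assoc]
  let f : KW F w k →ₗ[F] (Fin 2 → F) :=
    { toFun := fun x => ![x.1 a, x.1 b]
      map_add' := by intro x y; ext i; fin_cases i <;> simp
      map_smul' := by intro x y; ext i; fin_cases i <;> simp }
  have hf : Function.Bijective f := by
    constructor
    · rw [← LinearMap.ker_eq_bot, LinearMap.ker_eq_bot']
      rintro ⟨x, hx⟩ h0
      have ha : x a = 0 := congrFun h0 0
      have hb : x b = 0 := congrFun h0 1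
      have hc : x c = 0 := by
        have := hx.2
        rw [hs, ha, hb] at this; simpa using this
      ext z
      by_cases hz : phiW w z = k
      · rcases (h z).1 hz with rfl | rfl | rfl <;> assumption
      · exact hx.1 z hz
    · intro g
      refine ⟨⟨fun z => if z = a then g 0 else if z = b then g 1 else
        if z = c then -g 0 - g 1 else 0, ?_, ?_⟩, ?_⟩
      · intro z hz
        rw [Ne, h] at hz
        push Not at hz
        simp [hz.1, hz.2.1, hz.2.2]
      · rw [hs]; simp [hab.symm, hac.symm, hbc.symm]
      · ext i; fin_cases i <;> simp [f, hab.symm]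
  rw [(LinearEquiv.ofBijective f hf).finrank_eq]; simp

lemma decomp {F : Type*} [Field F] (h2 : (2 : F) ≠ 0) (h3 : (3 : F) ≠ 0)
    (w : ZMod 3 × ZMod 3) (hw : w ≠ 0) (c d k : ZMod 3) (hcd : c ≠ d) (hck : c ≠ k)
    (hdk : d ≠ k) (x : ZMod 3 × ZMod 3 → F) :
    ∃ y₁ ∈ Set.range (fun t : F => t • eW F w c), ∃ y₂ ∈ Set.range (fun t : F => t • eW F w d),
    ∃ y₃ ∈ Set.range (fun t : F => t • eW F w k),
      ∃ y₁₂ ∈ (KW F w k : Set (ZMod 3 × ZMod 3 → F)),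
      ∃ y₁₃ ∈ (KW F w d : Set (ZMod 3 × ZMod 3 → F)),
      ∃ y₂₃ ∈ (KW F w c : Set (ZMod 3 × ZMod 3 → F)),
        x = y₁ + y₂ + y₃ + y₁₂ + y₁₃ + y₂₃ ∧
        ∀ z₁ ∈ Set.range (fun t : F => t • eW F w c),
        ∀ z₂ ∈ Set.range (fun t : F => t • eW F w d),
        ∀ z₃ ∈ Set.range (fun t : F => t • eW F w k),
        ∀ z₁₂ ∈ (KW F w k : Set (ZMod 3 × ZMod 3 → F)),
        ∀ z₁₃ ∈ (KW F w d : Set (ZMod 3 × ZMod 3 → F)),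
        ∀ z₂₃ ∈ (KW F w c : Set (ZMod 3 × ZMod 3 → F)),
          x = z₁ + z₂ + z₃ + z₁₂ + z₁₃ + z₂₃ →
          z₁ = y₁ ∧ z₂ = y₂ ∧ z₃ = y₃ ∧ z₁₂ = y₁₂ ∧ z₁₃ = y₁₃ ∧ z₂₃ = y₂₃ := by
  have hcase : ∀ c d k t : ZMod 3, c ≠ d → c ≠ k → d ≠ k → t = c ∨ t = d ∨ t = k := by decide
  have hK : ∀ m, (fun z => if phiW w z = m then x z - sW w m x / 3 else 0) ∈ KW F w m := by
    intro m
    refine ⟨fun z hz => by simp [hz], ?_⟩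
    rw [sW_congr w m _ (x + fun _ => - (sW w m x / 3)), sW_add, sW_const w hw]
    · field_simp; ring
    · intro z hz; simp [hz]; ring
  refine ⟨_, ⟨(sW w d x + sW w k x) / 2, rfl⟩, _, ⟨(sW w c x + sW w k x) / 2, rfl⟩,
    _, ⟨(sW w c x + sW w d x) / 2, rfl⟩, _, hK k, _, hK d, _, hK c, ?_, ?_⟩
  · ext z
    rcases hcase c d k (phiW w z) hcd hck hdk with h | h | h <;>
      simp [eW, h, hcd, hck, hdk, hcd.symm, hck.symm, hdk.symm] <;> field_simp <;> ring
  · rintro _ ⟨t₁, rfl⟩ _ ⟨t₂, rfl⟩ _ ⟨t₃, rfl⟩ z₁₂ hz₁₂ z₁₃ hz₁₃ z₂₃ hz₂₃ hx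
    have hsum : ∀ m, sW w m x = t₁ * (if m = c then -1 else 1) + t₂ * (if m = d then -1 else 1)
        + t₃ * (if m = k then -1 else 1) := by
      intro m
      rw [hx]
      simp only [sW_add, sW_smul, sW_eW h3 w hw]
      rw [sW_off hz₁₂, sW_off hz₁₃, sW_off hz₂₃]; ring
    have hc := hsum c
    have hd := hsum d
    have hk := hsum k
    simp only [hcd, hck, hdk, hcd.symm, hck.symm, hdk.symm, if_true, if_false] at hc hd hk
    have key : ∀ z, x z = t₁ * eW F w c z + t₂ * eW F w d z + t₃ * eW F w k z
        + z₁₂ z + z₁₃ z + z₂₃ z := fun z => congrFun hx z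
    refine ⟨?_, ?_, ?_, ?_, ?_, ?_⟩
    · simp only [hd, hk]; congr 1; field_simp; ring
    · simp only [hc, hk]; congr 1; field_simp; ring
    · simp only [hc, hd]; congr 1; field_simp; ring
    · ext z
      split_ifs with h
      · have := key z
        rw [hz₁₃.1 z (by rw [h]; exact hdk.symm), hz₂₃.1 z (by rw [h]; exact hck.symm)] at this
        simp only [eW, h, hck.symm, hdk.symm, if_true, if_false] at this
        rw [this, hk]; field_simp; ring
      · exact hz₁₂.1 z h
    · ext z
      split_ifs with h
      · have := key z
        rw [hz₁₂.1 z (by rw [h]; exact hdk), hz₂₃.1 z (by rw [h]; exact hcd.symm)] at this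
        simp only [eW, h, hcd.symm, hdk, if_true, if_false] at this
        rw [this, hd]; field_simp; ring
      · exact hz₁₃.1 z h
    · ext z
      split_ifs with h
      · have := key z
        rw [hz₁₂.1 z (by rw [h]; exact hck), hz₁₃.1 z (by rw [h]; exact hcd)] at this
        simp only [eW, h, hck, hcd, if_true, if_false] at this
        rw [this, hc]; field_simp; ring
      · exact hz₂₃.1 z h

/-- Peirce-type decomposition of the Matsuo algebra of the affine plane of
order 3 (for `char F ∉ {2,3}`) with respect to the idempotents `e₁, e₂, e₃` of a parallel class
of lines: `A_{ij}` (the intersection of the `1/2`-eigenspaces of `e_i` and `e_j`) consists of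
the zero-coefficient-sum combinations of the points of the third line `L_k`, so
`dim A_{ij} = 2`, and `A = A₁₁ ⊕ A₂₂ ⊕ A₃₃ ⊕ A₁₂ ⊕ A₁₃ ⊕ A₂₃`. -/
theorem stmt_9 (F : Type*) [Field F] (h2 : (2 : F) ≠ 0) (h3 : (3 : F) ≠ 0)
    (a₁ a₂ a₃ w : ZMod 3 × ZMod 3) (hw : w ≠ 0)
    (h12 : lineThru a₁ w ≠ lineThru a₂ w) (h13 : lineThru a₁ w ≠ lineThru a₃ w)
    (h23 : lineThru a₂ w ≠ lineThru a₃ w) :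
    let e : Fin 3 → (ZMod 3 × ZMod 3 → F) := fun i =>
      (3⁻¹ : F) • pSum F Finset.univ - (2 / 3 : F) • pSum F (lineThru (![a₁, a₂, a₃] i) w)
    let A : Fin 3 → Fin 3 → Set (ZMod 3 × ZMod 3 → F) := fun i j =>
      if i = j then Set.range (fun t : F => t • e i)
      else {x | mMul F (e i) x = (2⁻¹ : F) • x ∧ mMul F (e j) x = (2⁻¹ : F) • x}
    let T : Fin 3 → Set (ZMod 3 × ZMod 3 → F) := fun k =>
      {x | ∃ g : ZMod 3 × ZMod 3 → F, (∑ u ∈ lineThru (![a₁, a₂, a₃] k) w, g u) = 0 ∧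
        x = ∑ u ∈ lineThru (![a₁, a₂, a₃] k) w, g u • (Pi.single u 1 : ZMod 3 × ZMod 3 → F)}
    (A 0 1 = T 2 ∧ A 0 2 = T 1 ∧ A 1 2 = T 0) ∧
    (∀ i j : Fin 3, i ≠ j → ∃ W : Submodule F (ZMod 3 × ZMod 3 → F),
      (W : Set (ZMod 3 × ZMod 3 → F)) = A i j ∧ Module.finrank F W = 2) ∧
    (∀ x : ZMod 3 × ZMod 3 → F,
      ∃ y₁ ∈ A 0 0, ∃ y₂ ∈ A 1 1, ∃ y₃ ∈ A 2 2,
      ∃ y₁₂ ∈ A 0 1, ∃ y₁₃ ∈ A 0 2, ∃ y₂₃ ∈ A 1 2,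
        x = y₁ + y₂ + y₃ + y₁₂ + y₁₃ + y₂₃ ∧
        ∀ z₁ ∈ A 0 0, ∀ z₂ ∈ A 1 1, ∀ z₃ ∈ A 2 2,
        ∀ z₁₂ ∈ A 0 1, ∀ z₁₃ ∈ A 0 2, ∀ z₂₃ ∈ A 1 2,
          x = z₁ + z₂ + z₃ + z₁₂ + z₁₃ + z₂₃ →
          z₁ = y₁ ∧ z₂ = y₂ ∧ z₃ = y₃ ∧ z₁₂ = y₁₂ ∧ z₁₃ = y₁₃ ∧ z₂₃ = y₂₃) := by
  have hne : ∀ a b, lineThru a w ≠ lineThru b w → phiW w a ≠ phiW w b := by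
    intro a b h h'
    exact h (by rw [line_eq a w hw, line_eq b w hw, h'])
  have n12 := hne _ _ h12
  have n13 := hne _ _ h13
  have n23 := hne _ _ h23
  intro e A T
  have he0 : e 0 = eW F w (phiW w a₁) := e_eq h3 a₁ w hw
  have he1 : e 1 = eW F w (phiW w a₂) := e_eq h3 a₂ w hw
  have he2 : e 2 = eW F w (phiW w a₃) := e_eq h3 a₃ w hw
  have A00 : A 0 0 = Set.range (fun t : F => t • eW F w (phiW w a₁)) := by
    rw [← he0]; exact if_pos rfl
  have A11 : A 1 1 = Set.range (fun t : F => t • eW F w (phiW w a₂)) := by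
    rw [← he1]; exact if_pos rfl
  have A22 : A 2 2 = Set.range (fun t : F => t • eW F w (phiW w a₃)) := by
    rw [← he2]; exact if_pos rfl
  have A01 : A 0 1 = KW F w (phiW w a₃) := by
    rw [← A_eq h2 h3 w hw _ _ _ n12 n13 n23, ← he0, ← he1]; exact if_neg (by decide)
  have A10 : A 1 0 = KW F w (phiW w a₃) := by
    rw [← A_eq h2 h3 w hw _ _ _ n12.symm n23 n13, ← he0, ← he1]; exact if_neg (by decide)
  have A02 : A 0 2 = KW F w (phiW w a₂) := by
    rw [← A_eq h2 h3 w hw _ _ _ n13 n12 n23.symm, ← he0, ← he2]; exact if_neg (by decide)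
  have A20 : A 2 0 = KW F w (phiW w a₂) := by
    rw [← A_eq h2 h3 w hw _ _ _ n13.symm n23.symm n12, ← he0, ← he2]; exact if_neg (by decide)
  have A12 : A 1 2 = KW F w (phiW w a₁) := by
    rw [← A_eq h2 h3 w hw _ _ _ n23 n12.symm n13.symm, ← he1, ← he2]; exact if_neg (by decide)
  have A21 : A 2 1 = KW F w (phiW w a₁) := by
    rw [← A_eq h2 h3 w hw _ _ _ n23.symm n13.symm n12.symm, ← he1, ← he2]
    exact if_neg (by decide)
  have T0 : T 0 = KW F w (phiW w a₁) := T_eq a₁ w hw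
  have T1 : T 1 = KW F w (phiW w a₂) := T_eq a₂ w hw
  have T2 : T 2 = KW F w (phiW w a₃) := T_eq a₃ w hw
  refine ⟨⟨A01.trans T2.symm, A02.trans T1.symm, A12.trans T0.symm⟩, ?_, ?_⟩
  · intro i j hij
    have r := KW_finrank (F := F) w hw
    fin_cases i <;> fin_cases j
    · exact absurd rfl hij
    · exact ⟨_, A01.symm, r _⟩
    · exact ⟨_, A02.symm, r _⟩
    · exact ⟨_, A10.symm, r _⟩
    · exact absurd rfl hij
    · exact ⟨_, A12.symm, r _⟩
    · exact ⟨_, A20.symm, r _⟩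
    · exact ⟨_, A21.symm, r _⟩
    · exact absurd rfl hij
  · intro x
    rw [A00, A11, A22, A01, A02, A12]
    exact decomp h2 h3 w hw _ _ _ n12 n13 n23 x
end

section
/- Let F be a field with char F ∉ {2,3}. Then the Matsuo algebra A of the affine plane of order 3 over F is isomorphic as an F-algebra to the Jordan algebra H₃(E,*) of hermitian 3×3 matrices over E = F[X]/(X²+3): there exists an F-linear bijection η : A → H₃(E,*) with η(xy) = η(x) ∙ η(y) for all x, y ∈ A. -/
open Finset

/-- First integer coordinate of twice the rank one projections of the Hesse configuration. -/
def hesseA (i k r s : Fin 3) : ℤ :=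
  if r = i ∨ s = i then 0 else if r = s then 1
  else if s = r + 1 then (![-1, 0, 1] : Fin 3 → ℤ) k else (![-1, 1, 0] : Fin 3 → ℤ) k

/-- Second integer coordinate (coefficient of the cube root of unity). -/
def hesseB (i k r s : Fin 3) : ℤ :=
  if r = i ∨ s = i then 0 else if r = s then 0
  else if s = r + 1 then (![0, -1, 1] : Fin 3 → ℤ) k else (![0, 1, -1] : Fin 3 → ℤ) k

/-- Twice the rank one projections of the Hesse configuration. -/
def hesseQ {E : Type*} [CommRing E] (w : E) (u : ZMod 3 × ZMod 3) :
    Matrix (Fin 3) (Fin 3) E := fun r s =>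
  (hesseA u.1 u.2 r s : E) + (hesseB u.1 u.2 r s : E) * w

theorem hesse_int1 : ∀ i k j l r s m n : Fin 3, m = - i - j → n = - k - l →
    (∑ t : Fin 3, (hesseA i k r t * hesseA j l t s - hesseB i k r t * hesseB j l t s
      + (hesseA j l r t * hesseA i k t s - hesseB j l r t * hesseB i k t s))) =
    if i = j ∧ k = l then 4 * hesseA i k r s
      else hesseA i k r s + hesseA j l r s - hesseA m n r s := by
  decide +kernel

theorem hesse_int2 : ∀ i k j l r s m n : Fin 3, m = - i - j → n = - k - l →
    (∑ t : Fin 3, (hesseA i k r t * hesseB j l t s + hesseB i k r t * hesseA j l t s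
        - hesseB i k r t * hesseB j l t s
      + (hesseA j l r t * hesseB i k t s + hesseB j l r t * hesseA i k t s
        - hesseB j l r t * hesseB i k t s))) =
    if i = j ∧ k = l then 4 * hesseB i k r s
      else hesseB i k r s + hesseB j l r s - hesseB m n r s := by
  decide +kernel

theorem hesseQ_mul {E : Type*} [CommRing E] (w : E) (hw : w * w = -1 - w)
    (u v : ZMod 3 × ZMod 3) :
    hesseQ w u * hesseQ w v + hesseQ w v * hesseQ w u =
      if u = v then (4 : E) • hesseQ w u
       else hesseQ w u + hesseQ w v - hesseQ w (-u - v) := by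
  obtain ⟨i, k⟩ := u
  obtain ⟨j, l⟩ := v
  ext r s
  have h1 := congrArg (fun n : ℤ => (n : E)) (hesse_int1 i k j l r s (-(i, k) - (j, l)).1 (-(i, k) - (j, l)).2 rfl rfl)
  have h2 := congrArg (fun n : ℤ => (n : E)) (hesse_int2 i k j l r s (-(i, k) - (j, l)).1 (-(i, k) - (j, l)).2 rfl rfl)
  have key : (hesseQ w (i, k) * hesseQ w (j, l) + hesseQ w (j, l) * hesseQ w (i, k)) r s =
      ((∑ t : Fin 3, (hesseA i k r t * hesseA j l t s - hesseB i k r t * hesseB j l t s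
      + (hesseA j l r t * hesseA i k t s - hesseB j l r t * hesseB i k t s)) : ℤ) : E) +
      ((∑ t : Fin 3, (hesseA i k r t * hesseB j l t s + hesseB i k r t * hesseA j l t s
        - hesseB i k r t * hesseB j l t s
      + (hesseA j l r t * hesseB i k t s + hesseB j l r t * hesseA i k t s
        - hesseB j l r t * hesseB i k t s)) : ℤ) : E) * w := by
    simp only [Matrix.add_apply, Matrix.mul_apply]
    push_cast
    rw [Finset.sum_mul, ← Finset.sum_add_distrib, ← Finset.sum_add_distrib]
    refine Finset.sum_congr rfl fun t _ => ?_
    simp only [hesseQ]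
    linear_combination ((hesseB i k r t : E) * hesseB j l t s
      + (hesseB j l r t : E) * hesseB i k t s) * hw
  rw [key]
  rw [h1, h2]
  by_cases h : i = j ∧ k = l
  · have h' : (i, k) = (j, l) := Prod.ext h.1 h.2
    rw [if_pos h']
    erw [if_pos h, if_pos h]
    simp only [Matrix.smul_apply, hesseQ, smul_eq_mul]
    push_cast
    ring
  · have h' : ¬ (i, k) = (j, l) := fun e => h ⟨congrArg Prod.fst e, congrArg Prod.snd e⟩
    rw [if_neg h']
    erw [if_neg h, if_neg h]
    rw [Matrix.sub_apply, Matrix.add_apply]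
    simp only [hesseQ]
    push_cast
    ring

theorem adj_repr (F : Type*) [Field F] (e : AdjoinRoot (Polynomial.X ^ 2 + Polynomial.C 3 : Polynomial F)) :
    ∃ a b : F, e = algebraMap F _ a + algebraMap F _ b * AdjoinRoot.root _ := by
  have hm : (Polynomial.X ^ 2 + Polynomial.C 3 : Polynomial F).Monic :=
    Polynomial.monic_X_pow_add_C 3 two_ne_zero
  obtain ⟨p, rfl⟩ := AdjoinRoot.mk_surjective e
  rw [← AdjoinRoot.mk_leftInverse hm (AdjoinRoot.mk _ p), AdjoinRoot.modByMonicHom_mk hm]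
  have hd : (p %ₘ (Polynomial.X ^ 2 + Polynomial.C 3 : Polynomial F)).degree ≤ 1 := by
    have := Polynomial.degree_modByMonic_lt p hm
    rw [Polynomial.degree_X_pow_add_C (by norm_num)] at this
    exact Order.le_of_lt_succ this
  rw [Polynomial.eq_X_add_C_of_degree_le_one hd]
  refine ⟨(p %ₘ (Polynomial.X ^ 2 + Polynomial.C 3 : Polynomial F)).coeff 0,
    (p %ₘ (Polynomial.X ^ 2 + Polynomial.C 3 : Polynomial F)).coeff 1, ?_⟩
  simp only [map_add, map_mul, AdjoinRoot.mk_X, AdjoinRoot.mk_C, AdjoinRoot.algebraMap_eq]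
  ring

theorem adj_zero (F : Type*) [Field F] (a b : F)
    (h : algebraMap F (AdjoinRoot (Polynomial.X ^ 2 + Polynomial.C 3 : Polynomial F)) a
      + algebraMap F _ b * AdjoinRoot.root _ = 0) : a = 0 ∧ b = 0 := by
  have hm : (Polynomial.X ^ 2 + Polynomial.C 3 : Polynomial F).Monic :=
    Polynomial.monic_X_pow_add_C 3 two_ne_zero
  have h' : AdjoinRoot.mk (Polynomial.X ^ 2 + Polynomial.C 3 : Polynomial F)
      (Polynomial.C b * Polynomial.X + Polynomial.C a) = 0 := by
    simp only [map_add, map_mul, AdjoinRoot.mk_X, AdjoinRoot.mk_C]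
    rw [← h, AdjoinRoot.algebraMap_eq]; ring
  rw [AdjoinRoot.mk_eq_zero] at h'
  have h0 := Polynomial.eq_zero_of_dvd_of_degree_lt h' (by
    rw [Polynomial.degree_X_pow_add_C (by norm_num)]
    exact lt_of_le_of_lt Polynomial.degree_linear_le (by norm_num))
  constructor
  · simpa using congrArg (fun q => Polynomial.coeff q 0) h0
  · simpa using congrArg (fun q => Polynomial.coeff q 1) h0

theorem adj_root (F : Type*) [Field F] :
    AdjoinRoot.root (Polynomial.X ^ 2 + Polynomial.C 3 : Polynomial F) *
      AdjoinRoot.root (Polynomial.X ^ 2 + Polynomial.C 3 : Polynomial F) = -3 := by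
  have := AdjoinRoot.eval₂_root (Polynomial.X ^ 2 + Polynomial.C 3 : Polynomial F)
  rw [Polynomial.eval₂_add, Polynomial.eval₂_X_pow, Polynomial.eval₂_C,
    map_ofNat (AdjoinRoot.of _) 3] at this
  linear_combination this
set_option maxHeartbeats 4000000 in
theorem hesse_core (F : Type*) [Field F] (h2 : (2 : F) ≠ 0) (h3 : (3 : F) ≠ 0)
    (E : Type*) [CommRing E] [Algebra F E] (z : E) (hzz : z * z = -3)
    (hrep : ∀ e : E, ∃ a b : F, e = algebraMap F E a + algebraMap F E b * z)
    (hzero : ∀ a b : F, algebraMap F E a + algebraMap F E b * z = 0 → a = 0 ∧ b = 0)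
    (σ : E →ₐ[F] E) (hσ : σ z = -z) :
    ∃ η : (ZMod 3 × ZMod 3 → F) → Matrix (Fin 3) (Fin 3) E,
      (∀ (c : F) (x y : ZMod 3 × ZMod 3 → F), η (c • x + y) = c • η x + η y) ∧
      Function.Injective η ∧
      Set.range η = {M : Matrix (Fin 3) (Fin 3) E | (M.map ⇑σ).transpose = M} ∧
      (∀ x y : ZMod 3 × ZMod 3 → F,
        η (mMul F x y) = (2⁻¹ : F) • (η x * η y + η y * η x)) := by
  let al : F →+* E := algebraMap F E
  have hh : al 2⁻¹ * 2 = 1 := by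
    have : al 2⁻¹ * al 2 = 1 := by rw [← map_mul, inv_mul_cancel₀ h2, map_one]
    rwa [map_ofNat al 2] at this
  have hcan : ∀ a b : E, 2 * a = 2 * b → a = b := by
    intro a b h
    linear_combination al 2⁻¹ * h - (a - b) * hh
  let w : E := al 2⁻¹ * (z - 1)
  have hw2 : 2 * w = z - 1 := by
    simp only [w]; linear_combination (z - 1) * hh
  have hw : w * w = -1 - w := by
    apply hcan
    apply hcan
    linear_combination (2 * w + z + 1) * hw2 + hzz
  have hσw : σ w = -1 - w := by
    apply hcan
    have := congrArg σ hw2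
    simp only [map_mul, map_sub, map_one, hσ, map_ofNat] at this
    linear_combination this + hw2
  let L := Fintype.linearCombination F (fun u => (2⁻¹ : F) • hesseQ w u)
  have hL1 : ∀ u, L (Pi.single u 1) = (2⁻¹ : F) • hesseQ w u := by
    intro u
    simp [L, Fintype.linearCombination_apply_single]
  have hL : ∀ x, L x = ∑ u, x u • (2⁻¹ : F) • hesseQ w u := fun x => rfl
  have hent : ∀ (x : ZMod 3 × ZMod 3 → F) (y : Fin 3 → Fin 3 → F) (hxy : ∀ i k, x (i, k) = y i k)
      (r s : Fin 3), 2 * L x r s =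
      al (∑ i : Fin 3, ∑ k : Fin 3, y i k * (hesseA i k r s : F)) +
      al (∑ i : Fin 3, ∑ k : Fin 3, y i k * (hesseB i k r s : F)) * w := by
    intro x y hxy r s
    have e1 : L x r s = ∑ i : Fin 3, ∑ k : Fin 3,
        al (y i k) * (al 2⁻¹ * ((hesseA i k r s : E) + (hesseB i k r s : E) * w)) := by
      rw [hL, Matrix.sum_apply, Fintype.sum_prod_type]
      refine Finset.sum_congr rfl fun i _ => Finset.sum_congr rfl fun k _ => ?_
      rw [hxy, Matrix.smul_apply, Matrix.smul_apply, Algebra.smul_def, Algebra.smul_def]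
      rfl
    rw [e1]
    simp only [map_sum, Finset.mul_sum, Finset.sum_mul, ← Finset.sum_add_distrib]
    refine Finset.sum_congr rfl fun i _ => Finset.sum_congr rfl fun k _ => ?_
    rw [map_mul, map_mul, map_intCast, map_intCast]
    linear_combination al (y i k) * ((hesseA i k r s : E) + (hesseB i k r s : E) * w) * hh
  refine ⟨L, fun c x y => by simp, ?_, ?_, ?_⟩
  · refine (injective_iff_map_eq_zero L).2 fun x hx => ?_
    obtain ⟨y, hxy⟩ : ∃ y : Fin 3 → Fin 3 → F, ∀ i k, x (i, k) = y i k :=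
      ⟨fun i k => x (i, k), fun _ _ => rfl⟩
    have hAB : ∀ r s : Fin 3, (∑ i : Fin 3, ∑ k : Fin 3, y i k * (hesseA i k r s : F)) = 0 ∧
        (∑ i : Fin 3, ∑ k : Fin 3, y i k * (hesseB i k r s : F)) = 0 := by
      intro r s
      have h := hent x y hxy r s
      rw [hx, Matrix.zero_apply] at h
      generalize (∑ i : Fin 3, ∑ k : Fin 3, y i k * (hesseA i k r s : F)) = a at *
      generalize (∑ i : Fin 3, ∑ k : Fin 3, y i k * (hesseB i k r s : F)) = b at *
      have := hzero (2 * a - b) b (by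
        change al _ + al _ * z = 0
        rw [map_sub, map_mul, map_ofNat]
        linear_combination -2 * h - al b * hw2)
      obtain ⟨ha, hb⟩ := this
      refine ⟨?_, hb⟩
      rw [hb, sub_zero] at ha
      exact (mul_eq_zero.1 ha).resolve_left h2
    have d0 := (hAB 0 0).1
    have d1 := (hAB 1 1).1
    have d2 := (hAB 2 2).1
    obtain ⟨a0, b0⟩ := hAB 1 2
    obtain ⟨a1, b1⟩ := hAB 2 0
    obtain ⟨a2, b2⟩ := hAB 0 1
    simp [Fin.sum_univ_three, hesseA, hesseB] at d0 d1 d2 a0 b0 a1 b1 a2 b2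
    have h6 : ∀ a : F, 2 * (3 * a) = 0 → a = 0 := fun a h =>
      (mul_eq_zero.1 ((mul_eq_zero.1 h).resolve_left h2)).resolve_left h3
    have t0 : y 0 2 = 0 := h6 _ (by linear_combination d1 + d2 - d0 + 2 * a0 + 2 * b0)
    have t1 : y 1 2 = 0 := h6 _ (by linear_combination d0 + d2 - d1 + 2 * a1 + 2 * b1)
    have t2 : y 2 2 = 0 := h6 _ (by linear_combination d0 + d1 - d2 + 2 * a2 + 2 * b2)
    clear hent hL1 hL hzero hrep h6 hAB hcan
    have hy : ∀ i k, y i k = 0 := by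
      intro i k
      fin_cases i <;> fin_cases k <;> simp <;> grind
    funext ⟨i, k⟩
    exact (hxy i k).trans (hy i k)
  · have hQσ : ∀ u r s, σ (hesseQ w u s r) = hesseQ w u r s := by
      intro u r s
      have e1 : ∀ i k r s : Fin 3, hesseA i k s r - hesseB i k s r = hesseA i k r s ∧
        hesseB i k s r = - hesseB i k r s := by decide +kernel
      obtain ⟨e1, e2⟩ := e1 u.1 u.2 r s
      simp only [hesseQ, map_add, map_mul, map_intCast, hσw]
      rw [← e1, e2]
      push_cast
      ring
    ext M
    constructor
    · rintro ⟨x, rfl⟩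
      ext r s
      rw [Matrix.transpose_apply, Matrix.map_apply, hL, Matrix.sum_apply, Matrix.sum_apply, map_sum]
      refine Finset.sum_congr rfl fun u _ => ?_
      simp only [Matrix.smul_apply, map_smul, hQσ]
    · intro hM
      choose a b hab using fun r s => hrep (M r s)
      have hsym : ∀ r s, a s r = a r s ∧ b s r = - b r s := by
        intro r s
        have h := congrFun (congrFun hM r) s
        rw [Matrix.transpose_apply, Matrix.map_apply, hab, hab] at h
        simp only [map_add, map_mul, AlgHom.commutes, hσ] at h
        have := hzero (a s r - a r s) (- b s r - b r s) (by
          simp only [map_sub, map_neg]; linear_combination h)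
        exact ⟨by linear_combination this.1, by linear_combination -this.2⟩
      let Y : Fin 3 → F := fun i => (a (i+1) (i+1) + a (i+2) (i+2) - a i i
        + 2 * a (i+1) (i+2) + 6 * b (i+1) (i+2)) * 3⁻¹
      have hY : ∀ i, 3 * Y i = a (i+1) (i+1) + a (i+2) (i+2) - a i i
        + 2 * a (i+1) (i+2) + 6 * b (i+1) (i+2) := by
        intro i
        simp only [Y]
        field_simp
      let y : Fin 3 → Fin 3 → F := fun i k =>
        if k = 0 then Y i - 2 * a (i+1) (i+2) - 2 * b (i+1) (i+2)
        else if k = 1 then Y i - 4 * b (i+1) (i+2) else Y i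
      have h0 := hY 0
      have h1 := hY 1
      have h2' := hY 2
      have s01 := hsym 0 1
      have s02 := hsym 0 2
      have s12 := hsym 1 2
      have s00 := (hsym 0 0).2
      have s11 := (hsym 1 1).2
      have s22 := (hsym 2 2).2
      have hself : ∀ t : F, t = -t → t = 0 := fun t ht =>
        (mul_eq_zero.1 (show 2 * t = 0 by linear_combination ht)).resolve_left h2
      replace s00 := hself _ s00
      replace s11 := hself _ s11
      replace s22 := hself _ s22
      have f1 : (1 : Fin 3) + 1 = 2 := rfl
      have f2 : (1 : Fin 3) + 2 = 0 := rfl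
      have f3 : (2 : Fin 3) + 1 = 0 := rfl
      have f4 : (2 : Fin 3) + 2 = 1 := rfl
      simp only [f1, f2, f3, f4, zero_add] at h0 h1 h2'
      refine ⟨fun u => y u.1 u.2, ?_⟩
      ext r s
      apply hcan
      rw [hent _ y (fun _ _ => rfl), hab]
      have hA : (∑ i : Fin 3, ∑ k : Fin 3, y i k * (hesseA i k r s : F)) =
          2 * a r s + 2 * b r s := by
        clear hent hL1 hL hzero hrep hcan hQσ hab hM hsym hself hY hw hw2 hσw hh hzz
        clear_value Y
        fin_cases r <;> fin_cases s <;>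
          simp [Fin.sum_univ_three, hesseA, y, f1, f2, f3, f4] <;> grind
      have hB : (∑ i : Fin 3, ∑ k : Fin 3, y i k * (hesseB i k r s : F)) = 4 * b r s := by
        clear hent hL1 hL hzero hrep hcan hQσ hab hM hsym hself hY hw hw2 hσw hh hzz
        clear_value Y
        fin_cases r <;> fin_cases s <;>
          simp [Fin.sum_univ_three, hesseB, y, f1, f2, f3, f4] <;> grind
      rw [hA, hB]
      simp only [map_add, map_mul, map_ofNat]
      change 2 * al _ + 2 * al _ + 4 * al _ * w = 2 * (al _ + al _ * z)
      linear_combination 2 * al (b r s) * hw2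
  · intro x y
    have h4 : (4⁻¹ : F) = 2⁻¹ * 2⁻¹ := by
      rw [← mul_inv]; norm_num
    rw [mMul, map_sum, hL x, hL y]
    simp only [Finset.sum_mul_sum, map_sum, map_smul]
    rw [Finset.sum_comm (s := univ) (t := univ) (f := fun j i => (y j • _) * (x i • _))]
    rw [← Finset.sum_add_distrib, Finset.smul_sum]
    refine Finset.sum_congr rfl fun u _ => ?_
    rw [← Finset.sum_add_distrib, Finset.smul_sum]
    refine Finset.sum_congr rfl fun v _ => ?_
    have hq := hesseQ_mul w hw u v
    have e : x u • (2⁻¹ : F) • hesseQ w u * y v • (2⁻¹ : F) • hesseQ w v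
       + y v • (2⁻¹ : F) • hesseQ w v * x u • (2⁻¹ : F) • hesseQ w u
       = (x u * y v * 2⁻¹ * 2⁻¹) • (hesseQ w u * hesseQ w v + hesseQ w v * hesseQ w u) := by
      simp only [smul_mul_assoc, mul_smul_comm, smul_smul, smul_add]
      congr 2 <;> ring
    rw [e, hq]
    split_ifs with h
    · rw [hL1]
      have : (4 : E) • hesseQ w u = (4 : F) • hesseQ w u := by
        ext r s; rw [Matrix.smul_apply, Matrix.smul_apply, smul_eq_mul,
          Algebra.smul_def (4 : F), map_ofNat (algebraMap F E) 4]
      rw [this]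
      simp only [smul_smul]
      congr 1
      field_simp
      norm_num
    · simp only [map_smul, map_sub, map_add, hL1, h4]
      simp only [← smul_add, ← smul_sub, smul_smul]
      congr 1
      ring

open Polynomial Matrix in
/-- For `char F ∉ {2,3}`, the Matsuo algebra of the affine plane of order 3
over `F` is isomorphic as an `F`-algebra to the Jordan algebra `H₃(E,*)` of hermitian `3 × 3`
matrices over the quadratic étale extension `E = F[X]/(X²+3)`, where `*` is conjugate
transposition with respect to the nontrivial `F`-automorphism `σ` of `E` (with `σ(ζ) = −ζ`)
and the Jordan product is `X ∙ Y = (1/2)(XY + YX)`. -/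
theorem stmt_10 (F : Type*) [Field F] (h2 : (2 : F) ≠ 0) (h3 : (3 : F) ≠ 0)
    (σ : AdjoinRoot (X ^ 2 + C 3 : Polynomial F) →ₐ[F] AdjoinRoot (X ^ 2 + C 3 : Polynomial F))
    (hσ : σ (AdjoinRoot.root (X ^ 2 + C 3 : Polynomial F)) =
      -AdjoinRoot.root (X ^ 2 + C 3 : Polynomial F)) :
    ∃ η : (ZMod 3 × ZMod 3 → F) →
        Matrix (Fin 3) (Fin 3) (AdjoinRoot (X ^ 2 + C 3 : Polynomial F)),
      (∀ (c : F) (x y : ZMod 3 × ZMod 3 → F), η (c • x + y) = c • η x + η y) ∧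
      Function.Injective η ∧
      Set.range η =
        {M : Matrix (Fin 3) (Fin 3) (AdjoinRoot (X ^ 2 + C 3 : Polynomial F)) |
          (M.map ⇑σ)ᵀ = M} ∧
      (∀ x y : ZMod 3 × ZMod 3 → F,
        η (mMul F x y) = (2⁻¹ : F) • (η x * η y + η y * η x)) := by
  exact hesse_core F h2 h3 _ _ (adj_root F) (adj_repr F) (adj_zero F) σ hσ
end

section
/- Let F be a field with char F ≠ 2, let α ∈ F with α ∉ {0,1}, let (G, D) be a 3-transposition group, and let c ∈ D. Then the Matsuo algebra M_α(G, D) is the internal direct sum of the eigenspaces of the left-multiplication operator ad(c) : a ↦ c·a for the three eigenvalues 1, 0 and α; moreover, the 1-eigenspace of ad(c) is exactly F·c. -/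
open scoped Classical in
/-- The Matsuo algebra `M_α(G,D)` of a 3-transposition group `(G,D)`: the free `F`-module
on `D`, with commutative bilinear multiplication determined by `c·c = c`, `c·d = 0` if
`c ≠ d` commute, and `c·d = (α/2)(c + d − cdc)` if `cd` has order 3 (then `cdc = dcd ∈ D`). -/
noncomputable def matsuoMul (F : Type*) [Field F] {G : Type*} [Group G] (D : Set G) (α : F)
    (x y : ↥D →₀ F) : ↥D →₀ F :=
  x.sum fun c xc => y.sum fun d yd => (xc * yd) •
    (if c = d then Finsupp.single c (1 : F)
     else if (c : G) * d = (d : G) * c then 0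
     else (α / 2) • (Finsupp.single c (1 : F) + Finsupp.single d (1 : F) -
       (if h : ∃ e : ↥D, (e : G) = c * d * c then Finsupp.single h.choose (1 : F) else 0)))



/-- Abstract decomposition for an operator with `L² - αL` landing in the line of a fixed vector. -/
lemma decomp_aux {F V : Type*} [Field F] [AddCommGroup V] [Module F V] (L : V →ₗ[F] V)
    (α : F) (hα0 : α ≠ 0) (hα1 : α ≠ 1) (c : V) (hc : L c = c)
    (hq : ∀ x, ∃ t : F, L (L x) - α • L x = t • c) :
    ({x : V | L x = x} = Set.range fun t : F => t • c) ∧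
    (∀ x : V, ∃ x1 x0 xa : V,
      L x1 = x1 ∧ L x0 = 0 ∧ L xa = α • xa ∧ x = x1 + x0 + xa ∧
      ∀ y1 y0 ya : V, L y1 = y1 → L y0 = 0 → L ya = α • ya →
        x = y1 + y0 + ya → y1 = x1 ∧ y0 = x0 ∧ ya = xa) := by
  have h1 : (1 - α) ≠ 0 := sub_ne_zero.2 (Ne.symm hα1)
  constructor
  · ext x
    simp only [Set.mem_ofPred_eq, Set.mem_range]
    constructor
    · intro hx
      obtain ⟨t, ht⟩ := hq x
      rw [hx, hx] at ht
      refine ⟨(1 - α)⁻¹ * t, ?_⟩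
      rw [mul_smul, ← ht]
      have : x - α • x = (1 - α) • x := by module
      rw [this, smul_smul, inv_mul_cancel₀ h1, one_smul]
    · rintro ⟨t, rfl⟩
      rw [map_smul, hc]
  · intro x
    obtain ⟨t, ht⟩ := hq x
    have hLL : L (L x) = α • L x + t • c := by rw [← ht]; abel
    refine ⟨((1 - α)⁻¹ * t) • c,
      x - ((1 - α)⁻¹ * t) • c - α⁻¹ • (L x - ((1 - α)⁻¹ * t) • c),
      α⁻¹ • (L x - ((1 - α)⁻¹ * t) • c), ?_, ?_, ?_, ?_, ?_⟩
    · simp [hc]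
    · simp only [map_sub, map_smul, hc, hLL]
      match_scalars <;> field_simp <;> ring
    · simp only [map_sub, map_smul, hc, hLL]
      match_scalars <;> field_simp <;> ring
    · abel
    · intro y1 y0 ya e1 e0 ea hx
      have hL : L x = y1 + α • ya := by rw [hx]; simp [e1, e0, ea]
      have hL2 : L (L x) = y1 + (α * α) • ya := by rw [hL]; simp [e1, ea, mul_smul]
      have hy1 : y1 = ((1 - α)⁻¹ * t) • c := by
        rw [mul_smul, ← ht, hL2, hL]
        match_scalars <;> field_simp <;> ring
      have hya : ya = α⁻¹ • (L x - ((1 - α)⁻¹ * t) • c) := by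
        rw [← hy1, hL]
        match_scalars <;> field_simp <;> ring
      refine ⟨hy1, ?_, hya⟩
      rw [← hya, ← hy1, hx]
      abel

/-- Let `char F ≠ 2`, `α ∉ {0,1}`, let `(G,D)` be a 3-transposition group and
`c ∈ D`.  Then the Matsuo algebra `M_α(G,D)` is the internal direct sum of the eigenspaces of
the left-multiplication operator `ad(c)` for the eigenvalues `1`, `0` and `α`; moreover the
`1`-eigenspace of `ad(c)` is exactly `F·c`. -/
theorem stmt_17 (F : Type*) [Field F] (h2 : (2 : F) ≠ 0) (α : F) (hα0 : α ≠ 0) (hα1 : α ≠ 1)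
    {G : Type*} [Group G] (D : Set G)
    (hinv : ∀ d ∈ D, d * d = 1 ∧ d ≠ 1)
    (hconj : ∀ d ∈ D, ∀ g : G, g * d * g⁻¹ ∈ D)
    (hgen : Subgroup.closure D = ⊤)
    (hord : ∀ c ∈ D, ∀ d ∈ D, orderOf (c * d) ≤ 3)
    (c : ↥D) :
    let ad : (↥D →₀ F) → (↥D →₀ F) := fun x => matsuoMul F D α (Finsupp.single c 1) x
    ({x : ↥D →₀ F | ad x = x} = Set.range fun t : F => t • Finsupp.single c (1 : F)) ∧
    (∀ x : ↥D →₀ F, ∃ x1 x0 xa : ↥D →₀ F,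
      ad x1 = x1 ∧ ad x0 = 0 ∧ ad xa = α • xa ∧ x = x1 + x0 + xa ∧
      ∀ y1 y0 ya : ↥D →₀ F, ad y1 = y1 → ad y0 = 0 → ad ya = α • ya →
        x = y1 + y0 + ya → y1 = x1 ∧ y0 = x0 ∧ ya = xa) := by
  intro ad
  classical
  have hcc : (c : G) * c = 1 := (hinv c c.2).1
  have hci : (c : G)⁻¹ = c := inv_eq_of_mul_eq_one_left hcc
  have hmem : ∀ d : ↥D, (c : G) * d * c ∈ D := fun d => by
    have := hconj d d.2 c
    rwa [hci] at this
  let τ : ↥D → ↥D := fun d => ⟨(c : G) * d * c, hmem d⟩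
  have hττ : ∀ d, τ (τ d) = d := fun d => by
    apply Subtype.ext
    show (c : G) * (c * d * c) * c = d
    calc (c : G) * (c * d * c) * c = (c * c) * d * (c * c) := by group
      _ = d := by rw [hcc]; simp
  have hτcomm : ∀ d : ↥D, (c : G) * τ d = (τ d : G) * c → (c : G) * d = d * c := by
    intro d h
    have h : (c : G) * (c * d * c) = c * d * c * c := h
    have h3 : (c : G) * (c * d * c) = d * c := by
      rw [← mul_assoc, ← mul_assoc, hcc, one_mul]
    have h4 : (c : G) * d * c * c = c * d := by rw [mul_assoc, hcc, mul_one]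
    rw [h3, h4] at h
    exact h.symm
  let v : ↥D → (↥D →₀ F) := fun d =>
    if c = d then Finsupp.single c (1 : F)
     else if (c : G) * d = (d : G) * c then 0
     else (α / 2) • (Finsupp.single c (1 : F) + Finsupp.single d (1 : F) -
       Finsupp.single (τ d) (1 : F))
  let L : (↥D →₀ F) →ₗ[F] (↥D →₀ F) := Finsupp.linearCombination F v
  have hchoose : ∀ d : ↥D, (if h : ∃ e : ↥D, (e : G) = c * d * c then
      Finsupp.single h.choose (1 : F) else 0) = Finsupp.single (τ d) (1 : F) := by
    intro d
    have h : ∃ e : ↥D, (e : G) = c * d * c := ⟨τ d, rfl⟩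
    rw [dif_pos h]
    congr 1
    exact Subtype.ext h.choose_spec
  have had : ad = fun x => L x := by
    funext x
    show matsuoMul F D α (Finsupp.single c 1) x = Finsupp.linearCombination F v x
    unfold matsuoMul
    rw [Finsupp.sum_single_index (by simp), Finsupp.linearCombination_apply]
    refine Finsupp.sum_congr fun d _ => ?_
    rw [one_mul]
    congr 1
    simp only [v]
    rw [hchoose d]
  have hLs : ∀ d, L (Finsupp.single d 1) = v d := fun d => by
    simp [L]
  have hLc : L (Finsupp.single c 1) = Finsupp.single c 1 := by
    rw [hLs]; simp [v]
  have key : ∀ d : ↥D, ∃ t : F, L (L (Finsupp.single d 1)) - α • L (Finsupp.single d 1)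
      = t • Finsupp.single c 1 := by
    intro d
    by_cases h1 : c = d
    · subst h1
      refine ⟨1 - α, ?_⟩
      rw [hLc, hLc]
      module
    by_cases h3 : (c : G) * d = d * c
    · refine ⟨0, ?_⟩
      have : v d = 0 := by simp only [v]; rw [if_neg h1, if_pos h3]
      rw [hLs, this]; simp
    have hvd : ∀ e : ↥D, (c : G) * e ≠ e * c → v e = (α / 2) • (Finsupp.single c (1 : F) +
        Finsupp.single e (1 : F) - Finsupp.single (τ e) (1 : F)) := by
      intro e he
      simp only [v]
      rw [if_neg (by rintro rfl; exact he rfl), if_neg he]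
    have hA := hvd d h3
    have hB := hvd (τ d) (fun h => h3 (hτcomm d h))
    rw [hττ] at hB
    refine ⟨α / 2 * (1 - α), ?_⟩
    rw [hLs, hA, map_smul, map_sub, map_add, hLc, hLs, hLs, hA, hB]
    match_scalars <;> field_simp <;> ring
  rw [had]
  refine decomp_aux L α hα0 hα1 _ hLc ?_
  intro x
  induction x using Finsupp.induction_linear with
  | zero => exact ⟨0, by simp⟩
  | add x y hx hy =>
    obtain ⟨s, hs⟩ := hx
    obtain ⟨t, ht⟩ := hy
    refine ⟨s + t, ?_⟩
    rw [add_smul, ← hs, ← ht]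
    simp only [map_add, smul_add]
    abel
  | single d r =>
    obtain ⟨t, ht⟩ := key d
    refine ⟨r * t, ?_⟩
    have : Finsupp.single d r = r • Finsupp.single d (1 : F) := by simp
    rw [this, mul_smul, ← ht]
    simp only [map_smul]
    module
end
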